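/- arXiv:2306.04638 — 2 statements merged into one kernel-verified Lean document; each statement's English description precedes it below -/
import Mathlib

section
/- The convergent series ∑_{k=1}^∞ (H_{2k} − H_k)/(k·2^k·C(3k,k)) equals 3·(log 2)²/10 + π·(log 2)/20 − π²/60. -/
open scoped BigOperators

/-- The `m`-th harmonic number `H_m = ∑_{j=1}^m 1/j`. -/
noncomputable def harmonicNum (m : ℕ) : ℝ := ∑ j ∈ Finset.range m, 1 / (j + 1 : ℝ)

open MeasureTheory Set intervalIntegral

lemma intervalIntegrable_log_mul {f : ℝ → ℝ} (hf : ContinuousOn f (Icc 0 1)) :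
    IntervalIntegrable (fun x => Real.log x * f x) volume 0 1 :=
  intervalIntegrable_log'.mul_continuousOn (by rwa [uIcc_of_le zero_le_one])

lemma intervalIntegrable_log_one_sub_mul {f : ℝ → ℝ} (hf : ContinuousOn f (Icc 0 1)) :
    IntervalIntegrable (fun x => Real.log (1 - x) * f x) volume 0 1 := by
  have h := (intervalIntegrable_log' (a := 1) (b := 0)).comp_sub_left 1
  simp only [sub_self, sub_zero] at h
  exact h.mul_continuousOn (by rwa [uIcc_of_le zero_le_one])

lemma intervalIntegrable_log_one_add_mul {f : ℝ → ℝ} (hf : ContinuousOn f (Icc 0 1)) :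
    IntervalIntegrable (fun x => Real.log (1 + x) * f x) volume 0 1 := by
  apply ContinuousOn.intervalIntegrable
  rw [uIcc_of_le zero_le_one]
  exact ((continuousOn_const.add continuousOn_id).log
    (fun x hx => ne_of_gt (add_pos_of_pos_of_nonneg one_pos hx.1))).mul hf

lemma integral_comp_one_sub_unit (g : ℝ → ℝ) :
    ∫ x in (0 : ℝ)..1, g (1 - x) = ∫ x in (0 : ℝ)..1, g x := by
  simp [integral_comp_sub_left]

lemma integral_unit_eq_of_image {f f' : ℝ → ℝ} (hf : ∀ x ∈ Ioo (0 : ℝ) 1, HasDerivAt f (f' x) x)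
    (hinj : InjOn f (Ioo 0 1)) (him : f '' Ioo 0 1 = Ioo 0 1) (g : ℝ → ℝ) :
    ∫ x in (0 : ℝ)..1, g x = ∫ x in (0 : ℝ)..1, |f' x| * g (f x) := by
  have h := integral_image_eq_integral_abs_deriv_smul measurableSet_Ioo
    (fun x hx => (hf x hx).hasDerivWithinAt) hinj g
  rw [him] at h
  simpa only [integral_of_le zero_le_one, integral_Ioc_eq_integral_Ioo, smul_eq_mul] using h

lemma integral_comp_sq_unit (g : ℝ → ℝ) :
    ∫ x in (0 : ℝ)..1, g x = ∫ x in (0 : ℝ)..1, 2 * x * g (x ^ 2) := by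
  rw [integral_unit_eq_of_image (f := fun x => x ^ 2) (f' := fun x => 2 * x)]
  · refine integral_congr_Ioo_of_le zero_le_one fun x hx => ?_
    simp only [abs_of_pos (mul_pos two_pos hx.1)]
  · intro x _
    simpa using hasDerivAt_pow 2 x
  · intro x hx y hy h
    exact (pow_left_inj₀ hx.1.le hy.1.le two_ne_zero).1 h
  · ext y
    constructor
    · rintro ⟨x, hx, rfl⟩
      exact ⟨pow_pos hx.1 2, pow_lt_one₀ hx.1.le hx.2 two_ne_zero⟩
    · intro hy
      exact ⟨√y, ⟨Real.sqrt_pos.2 hy.1, by rw [Real.sqrt_lt' one_pos]; simpa using hy.2⟩,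
        Real.sq_sqrt hy.1.le⟩

/-- The substitution `x = (1 - t) / (1 + t)`, an involution of the unit interval. -/
lemma integral_comp_cayley_unit (g : ℝ → ℝ) :
    ∫ x in (0 : ℝ)..1, g x =
      ∫ t in (0 : ℝ)..1, 2 / (1 + t) ^ 2 * g ((1 - t) / (1 + t)) := by
  have hmap : ∀ t ∈ Ioo (0 : ℝ) 1, (1 - t) / (1 + t) ∈ Ioo (0 : ℝ) 1 := fun t ht => by
    have h1 := ht.1
    have h2 := ht.2
    exact ⟨div_pos (by linarith) (by linarith), by rw [div_lt_one] <;> linarith⟩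
  have hinv : ∀ t ∈ Ioo (0 : ℝ) 1, (1 - (1 - t) / (1 + t)) / (1 + (1 - t) / (1 + t)) = t :=
    fun t ht => by
      have h1 : 1 + t ≠ 0 := by linarith [ht.1]
      field_simp
      ring
  rw [integral_unit_eq_of_image (f := fun t => (1 - t) / (1 + t))
    (f' := fun t => -(2 / (1 + t) ^ 2))]
  · refine integral_congr_Ioo_of_le zero_le_one fun x hx => ?_
    have : 0 < 2 / (1 + x) ^ 2 := by have := hx.1; positivity
    simp only [abs_neg, abs_of_pos this]
  · intro x hx
    have h1 : 1 + x ≠ 0 := by linarith [hx.1]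
    have := ((hasDerivAt_id x).const_sub 1).div ((hasDerivAt_id x).const_add 1) h1
    refine this.congr_deriv ?_
    simp only [id_eq]
    field_simp
    ring
  · intro x hx y hy h
    rw [← hinv x hx, ← hinv y hy]
    simp only at h
    rw [h]
  · ext y
    exact ⟨by rintro ⟨x, hx, rfl⟩; exact hmap x hx, fun hy => ⟨_, hmap y hy, hinv y hy⟩⟩

lemma integral_log_mul_pow (n : ℕ) :
    ∫ x in (0 : ℝ)..1, Real.log x * x ^ n = -1 / ((n : ℝ) + 1) ^ 2 := by
  have hn : (n : ℝ) + 1 ≠ 0 := by positivity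
  rw [integral_eq_sub_of_hasDerivAt_of_le (f := fun x =>
    x ^ n * (x * Real.log x) / (n + 1) - x ^ (n + 1) / ((n : ℝ) + 1) ^ 2) zero_le_one]
  · simp
    field_simp
  · have := Real.continuous_mul_log
    fun_prop
  · intro x hx
    have h0 : x ≠ 0 := hx.1.ne'
    have h1 := (((hasDerivAt_pow n x).mul (Real.hasDerivAt_mul_log h0)).div_const ((n : ℝ) + 1)).sub
      ((hasDerivAt_pow (n + 1) x).div_const (((n : ℝ) + 1) ^ 2))
    refine h1.congr_deriv ?_
    rcases n with _ | n
    · simp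
    · push_cast at hn ⊢
      field_simp
      ring
  · exact intervalIntegrable_log_mul (by fun_prop)

lemma harmonicNum_succ (m : ℕ) : harmonicNum (m + 1) = harmonicNum m + 1 / (m + 1 : ℝ) :=
  Finset.sum_range_succ _ _

lemma integral_log_one_sub_mul_pow_mul_pow (a b : ℕ) :
    ∫ x in (0 : ℝ)..1, Real.log (1 - x) * (x ^ a * (1 - x) ^ b) =
      (a.factorial * b.factorial / (a + b + 1).factorial : ℝ) *
        (harmonicNum b - harmonicNum (a + b + 1)) := by
  induction a generalizing b with
  | zero =>
    have h := integral_comp_one_sub_unit (fun x => Real.log x * x ^ b)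
    simp only [pow_zero, one_mul]
    rw [h, integral_log_mul_pow, zero_add, harmonicNum_succ, Nat.factorial_succ]
    have : (b.factorial : ℝ) ≠ 0 := by positivity
    have : (b : ℝ) + 1 ≠ 0 := by positivity
    push_cast
    field_simp
    simp
  | succ a ih =>
    have h : ∀ x : ℝ, Real.log (1 - x) * (x ^ (a + 1) * (1 - x) ^ b) =
        Real.log (1 - x) * (x ^ a * (1 - x) ^ b) -
          Real.log (1 - x) * (x ^ a * (1 - x) ^ (b + 1)) := fun x => by ring
    simp only [h]
    rw [intervalIntegral.integral_sub (intervalIntegrable_log_one_sub_mul (by fun_prop))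
      (intervalIntegrable_log_one_sub_mul (by fun_prop)), ih, ih,
      show a + 1 + b + 1 = (a + b + 1) + 1 by ring, show a + (b + 1) + 1 = (a + b + 1) + 1 by ring,
      harmonicNum_succ b, harmonicNum_succ (a + b + 1), Nat.factorial_succ (a + b + 1),
      Nat.factorial_succ a, Nat.factorial_succ b]
    have : ((a + b + 1).factorial : ℝ) ≠ 0 := by positivity
    have : (b : ℝ) + 1 ≠ 0 := by positivity
    have : (a : ℝ) + b + 1 + 1 ≠ 0 := by positivity
    push_cast
    field_simp
    ring

lemma integral_log_mul_pow_mul_pow (a b : ℕ) :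
    ∫ x in (0 : ℝ)..1, Real.log x * (x ^ a * (1 - x) ^ b) =
      (a.factorial * b.factorial / (a + b + 1).factorial : ℝ) *
        (harmonicNum a - harmonicNum (a + b + 1)) := by
  have h := integral_comp_one_sub_unit (fun x => Real.log x * (x ^ a * (1 - x) ^ b))
  have h' := integral_log_one_sub_mul_pow_mul_pow b a
  rw [← h, add_comm a b, mul_comm (a.factorial : ℝ), ← h']
  congr 1
  ext x
  ring_nf

lemma integral_log_div_one_add :
    ∫ x in (0 : ℝ)..1, Real.log x * (1 / (1 + x)) = -Real.pi ^ 2 / 12 := by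
  have hint : ∀ n : ℕ, IntervalIntegrable (fun x => Real.log x * (-x) ^ n) volume 0 1 :=
    fun n => intervalIntegrable_log_mul (by fun_prop)
  have hz : HasSum (fun n : ℕ => 1 / ((n : ℝ) + 1) ^ 2) (Real.pi ^ 2 / 6) := by
    have := (hasSum_nat_add_iff' 1).2 hasSum_zeta_two
    simpa using this
  have hnorm : ∀ n : ℕ, ∫ x in Ioo (0 : ℝ) 1, ‖Real.log x * (-x) ^ n‖ = 1 / ((n : ℝ) + 1) ^ 2 := by
    intro n
    have h := integral_log_mul_pow n
    rw [integral_of_le zero_le_one, integral_Ioc_eq_integral_Ioo] at h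
    rw [← neg_inj, ← neg_div, ← h, ← MeasureTheory.integral_neg]
    refine setIntegral_congr_fun measurableSet_Ioo fun x hx => ?_
    simp only [norm_mul, norm_pow, norm_neg, Real.norm_eq_abs, abs_of_pos hx.1,
      abs_of_neg (Real.log_neg hx.1 hx.2), neg_mul, neg_neg]
  have hsum := hasSum_integral_of_summable_integral_norm (μ := volume.restrict (Ioo (0 : ℝ) 1))
    (F := fun (n : ℕ) x => Real.log x * (-x) ^ n)
    (fun n => (intervalIntegrable_iff_integrableOn_Ioo_of_le zero_le_one).1 (hint n))
    (by simpa only [hnorm] using hz.summable)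
  have hval : ∀ n : ℕ, ∫ x in Ioo (0 : ℝ) 1, Real.log x * (-x) ^ n =
      -((-1) ^ n / ((n : ℝ) + 1) ^ 2) := by
    intro n
    have h := integral_log_mul_pow n
    rw [integral_of_le zero_le_one, integral_Ioc_eq_integral_Ioo] at h
    have h2 : ∀ x : ℝ, Real.log x * (-x) ^ n = (-1) ^ n * (Real.log x * x ^ n) := fun x => by
      rw [neg_pow]; ring
    simp only [h2]
    rw [MeasureTheory.integral_const_mul, h]
    ring
  simp only [hval] at hsum
  have heq : ∫ x in Ioo (0 : ℝ) 1, ∑' n : ℕ, Real.log x * (-x) ^ n =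
      ∫ x in (0 : ℝ)..1, Real.log x * (1 / (1 + x)) := by
    rw [integral_of_le zero_le_one, integral_Ioc_eq_integral_Ioo]
    refine setIntegral_congr_fun measurableSet_Ioo fun x hx => ?_
    rw [tsum_mul_left, tsum_geometric_of_norm_lt_one, sub_neg_eq_add, one_div]
    rw [norm_neg, Real.norm_eq_abs, abs_of_pos hx.1]
    exact hx.2
  rw [heq] at hsum
  have halt : HasSum (fun n : ℕ => -((-1) ^ n / ((n : ℝ) + 1) ^ 2)) (-Real.pi ^ 2 / 12) := by
    have h := (hasSum_nat_add_iff' 1).2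
      (hasSum_one_div_nat_pow_mul_cos one_ne_zero (x := 1 / 2) (by norm_num))
    have h3 : Polynomial.eval (1 / 2 : ℝ) (Polynomial.map (algebraMap ℚ ℝ)
        (Polynomial.bernoulli 2)) = -1 / 12 := by
      simp [Polynomial.bernoulli_def, Finset.sum_range_succ, bernoulli_one, bernoulli_two]
      norm_num
    have h4 : ∀ n : ℕ, Real.cos (2 * Real.pi * ((n + 1 : ℕ) : ℝ) * (1 / 2)) = -(-1) ^ n := by
      intro n
      rw [show 2 * Real.pi * ((n + 1 : ℕ) : ℝ) * (1 / 2) = ((n + 1 : ℕ) : ℝ) * Real.pi by ring,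
        Real.cos_nat_mul_pi, pow_succ]
      ring
    simp only [h4, mul_one, h3] at h
    have hf : (fun n : ℕ => -((-1 : ℝ) ^ n / ((n : ℝ) + 1) ^ 2)) =
        fun n : ℕ => 1 / ((n + 1 : ℕ) : ℝ) ^ 2 * -(-1) ^ n := by
      ext n
      push_cast
      ring
    have hv : -Real.pi ^ 2 / 12 = (-1) ^ (1 + 1) * (2 * Real.pi) ^ 2 / 2 /
        (Nat.factorial 2 : ℝ) * (-1 / 12) -
        ∑ n ∈ Finset.range 1, 1 / (n : ℝ) ^ 2 * Real.cos (2 * Real.pi * n * (1 / 2)) := by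
      simp
      ring
    rw [hf, hv]
    exact h
  exact hsum.unique halt

lemma integral_log_one_add_div_one_add :
    ∫ x in (0 : ℝ)..1, Real.log (1 + x) * (1 / (1 + x)) = Real.log 2 ^ 2 / 2 := by
  rw [integral_eq_sub_of_hasDerivAt_of_le (f := fun x => Real.log (1 + x) ^ 2 / 2) zero_le_one]
  · norm_num
  · refine ContinuousOn.div_const (ContinuousOn.pow (ContinuousOn.log (by fun_prop) ?_) 2) 2
    intro x hx
    linarith [hx.1]
  · intro x hx
    have h1 : 1 + x ≠ 0 := by linarith [hx.1]
    refine (((((hasDerivAt_id x).const_add 1).log h1).pow 2).div_const 2).congr_deriv ?_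
    simp
    ring
  · exact intervalIntegrable_log_one_add_mul
      (continuousOn_const.div (by fun_prop) fun x hx => by linarith [hx.1])

lemma continuousOn_one_div_one_add : ContinuousOn (fun x : ℝ => 1 / (1 + x)) (Icc 0 1) :=
  continuousOn_const.div (by fun_prop) fun x hx => by linarith [hx.1]

lemma continuousOn_one_div_two_sub : ContinuousOn (fun x : ℝ => 1 / (2 - x)) (Icc 0 1) :=
  continuousOn_const.div (by fun_prop) fun x hx => by linarith [hx.2]

lemma continuous_one_div_one_add_sq : Continuous (fun x : ℝ => 1 / (1 + x ^ 2)) :=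
  continuous_const.div (by fun_prop) fun x => by positivity

lemma continuous_div_one_add_sq : Continuous (fun x : ℝ => x / (1 + x ^ 2)) :=
  continuous_id.div (by fun_prop) fun x => by positivity

lemma log_one_sub_cayley {t : ℝ} (ht : t ∈ Ioo (0 : ℝ) 1) :
    Real.log (1 - (1 - t) / (1 + t)) = Real.log 2 + Real.log t - Real.log (1 + t) := by
  have h0 := ht.1
  have h1 : 1 + t ≠ 0 := by linarith
  rw [show 1 - (1 - t) / (1 + t) = 2 * t / (1 + t) by field_simp; ring,
    Real.log_div (by positivity) h1, Real.log_mul two_ne_zero h0.ne']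

lemma log_one_add_cayley {t : ℝ} (ht : t ∈ Ioo (0 : ℝ) 1) :
    Real.log (1 + (1 - t) / (1 + t)) = Real.log 2 - Real.log (1 + t) := by
  have h0 := ht.1
  have h1 : 1 + t ≠ 0 := by linarith
  rw [show 1 + (1 - t) / (1 + t) = 2 / (1 + t) by field_simp; ring,
    Real.log_div two_ne_zero h1]

lemma integral_log_one_sub_div_one_add :
    ∫ x in (0 : ℝ)..1, Real.log (1 - x) * (1 / (1 + x)) =
      Real.log 2 ^ 2 / 2 - Real.pi ^ 2 / 12 := by
  rw [integral_comp_cayley_unit]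
  have h : ∫ t in (0 : ℝ)..1, 2 / (1 + t) ^ 2 *
      (Real.log (1 - (1 - t) / (1 + t)) * (1 / (1 + (1 - t) / (1 + t)))) =
      ∫ t in (0 : ℝ)..1, (Real.log 2 * (1 / (1 + t)) + Real.log t * (1 / (1 + t)) -
        Real.log (1 + t) * (1 / (1 + t))) := by
    refine integral_congr_Ioo_of_le zero_le_one fun t ht => ?_
    simp only [log_one_sub_cayley ht]
    have h1 : 1 + t ≠ 0 := by linarith [ht.1]
    field_simp
    ring
  have hc := continuousOn_one_div_one_add
  have h2 : ∫ t in (0 : ℝ)..1, 1 / (1 + t) = Real.log 2 := by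
    rw [integral_comp_add_left (fun t => 1 / t) 1, integral_one_div_of_pos (by norm_num) (by norm_num)]
    norm_num
  have i1 : IntervalIntegrable (fun t : ℝ => Real.log 2 * (1 / (1 + t))) volume 0 1 :=
    ContinuousOn.intervalIntegrable
      (by rw [uIcc_of_le zero_le_one]; exact continuousOn_const.mul hc)
  rw [h, intervalIntegral.integral_sub (i1.add (intervalIntegrable_log_mul hc))
      (intervalIntegrable_log_one_add_mul hc),
    intervalIntegral.integral_add i1 (intervalIntegrable_log_mul hc),
    intervalIntegral.integral_const_mul, h2, integral_log_div_one_add,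
    integral_log_one_add_div_one_add]
  ring

lemma integral_log_div_two_sub :
    ∫ x in (0 : ℝ)..1, Real.log x * (1 / (2 - x)) = Real.log 2 ^ 2 / 2 - Real.pi ^ 2 / 12 := by
  rw [← integral_log_one_sub_div_one_add, ← integral_comp_one_sub_unit]
  congr 1
  ext x
  ring_nf

lemma integral_log_one_sub_div_two_sub :
    ∫ x in (0 : ℝ)..1, Real.log (1 - x) * (1 / (2 - x)) = -Real.pi ^ 2 / 12 := by
  rw [← integral_log_div_one_add, ← integral_comp_one_sub_unit]
  congr 1
  ext x
  ring_nf

lemma integral_log_mul_div_one_add_sq :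
    ∫ x in (0 : ℝ)..1, Real.log x * (x / (1 + x ^ 2)) = -Real.pi ^ 2 / 48 := by
  have h := integral_log_div_one_add
  rw [integral_comp_sq_unit] at h
  have h2 : ∫ x in (0 : ℝ)..1, 2 * x * (Real.log (x ^ 2) * (1 / (1 + x ^ 2))) =
      ∫ x in (0 : ℝ)..1, 4 * (Real.log x * (x / (1 + x ^ 2))) := by
    congr 1
    ext x
    rw [Real.log_pow]
    push_cast
    ring
  rw [h2, intervalIntegral.integral_const_mul] at h
  linarith

lemma integral_log_one_add_div_one_add_sq :
    ∫ x in (0 : ℝ)..1, Real.log (1 + x) * (1 / (1 + x ^ 2)) = Real.pi * Real.log 2 / 8 := by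
  have hc := continuous_one_div_one_add_sq
  have h := integral_comp_cayley_unit (fun x => Real.log (1 + x) * (1 / (1 + x ^ 2)))
  have h2 : ∫ t in (0 : ℝ)..1, 2 / (1 + t) ^ 2 * (Real.log (1 + (1 - t) / (1 + t)) *
      (1 / (1 + ((1 - t) / (1 + t)) ^ 2))) =
      ∫ t in (0 : ℝ)..1, (Real.log 2 * (1 / (1 + t ^ 2)) -
        Real.log (1 + t) * (1 / (1 + t ^ 2))) := by
    refine integral_congr_Ioo_of_le zero_le_one fun t ht => ?_
    simp only [log_one_add_cayley ht]
    have h0 := ht.1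
    have h1 : 1 + t ≠ 0 := by linarith
    rw [show 1 + ((1 - t) / (1 + t)) ^ 2 = 2 * (1 + t ^ 2) / (1 + t) ^ 2 by field_simp; ring]
    field_simp
  have h3 : ∫ t in (0 : ℝ)..1, 1 / (1 + t ^ 2) = Real.pi / 4 := by
    simp
  rw [h2, intervalIntegral.integral_sub ((hc.const_mul _).intervalIntegrable 0 1)
    (intervalIntegrable_log_one_add_mul hc.continuousOn), intervalIntegral.integral_const_mul,
    h3] at h
  linarith

lemma integral_log_one_sub_sub_log_div_one_add_sq :
    (∫ x in (0 : ℝ)..1, Real.log (1 - x) * (1 / (1 + x ^ 2))) -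
      ∫ x in (0 : ℝ)..1, Real.log x * (1 / (1 + x ^ 2)) = Real.pi * Real.log 2 / 8 := by
  have hc := continuous_one_div_one_add_sq
  have h := integral_comp_cayley_unit (fun x => Real.log (1 - x) * (1 / (1 + x ^ 2)))
  have h2 : ∫ t in (0 : ℝ)..1, 2 / (1 + t) ^ 2 * (Real.log (1 - (1 - t) / (1 + t)) *
      (1 / (1 + ((1 - t) / (1 + t)) ^ 2))) =
      ∫ t in (0 : ℝ)..1, (Real.log 2 * (1 / (1 + t ^ 2)) + Real.log t * (1 / (1 + t ^ 2)) -
        Real.log (1 + t) * (1 / (1 + t ^ 2))) := by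
    refine integral_congr_Ioo_of_le zero_le_one fun t ht => ?_
    simp only [log_one_sub_cayley ht]
    have h0 := ht.1
    have h1 : 1 + t ≠ 0 := by linarith
    rw [show 1 + ((1 - t) / (1 + t)) ^ 2 = 2 * (1 + t ^ 2) / (1 + t) ^ 2 by field_simp; ring]
    field_simp
  have h3 : ∫ t in (0 : ℝ)..1, 1 / (1 + t ^ 2) = Real.pi / 4 := by
    simp
  have i1 := (hc.const_mul (Real.log 2)).intervalIntegrable (μ := volume) 0 1
  have i2 := intervalIntegrable_log_mul hc.continuousOn
  rw [h2, intervalIntegral.integral_sub (i1.add i2)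
    (intervalIntegrable_log_one_add_mul hc.continuousOn), intervalIntegral.integral_add i1 i2,
    intervalIntegral.integral_const_mul, h3, integral_log_one_add_div_one_add_sq] at h
  linarith

lemma integral_log_one_sub_mul_div_one_add_sq :
    ∫ x in (0 : ℝ)..1, Real.log (1 - x) * (x / (1 + x ^ 2)) =
      Real.log 2 ^ 2 / 8 - 5 * Real.pi ^ 2 / 96 := by
  have hc := continuous_div_one_add_sq
  have i1 := intervalIntegrable_log_one_sub_mul hc.continuousOn
  have i2 := intervalIntegrable_log_one_add_mul hc.continuousOn
  have hadd : (∫ x in (0 : ℝ)..1, Real.log (1 - x) * (x / (1 + x ^ 2))) +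
      ∫ x in (0 : ℝ)..1, Real.log (1 + x) * (x / (1 + x ^ 2)) =
      (Real.log 2 ^ 2 / 2 - Real.pi ^ 2 / 12) / 2 := by
    rw [← intervalIntegral.integral_add i1 i2, ← integral_log_one_sub_div_one_add,
      integral_comp_sq_unit (fun x => Real.log (1 - x) * (1 / (1 + x))),
      ← intervalIntegral.integral_div]
    refine integral_congr_Ioo_of_le zero_le_one fun x hx => ?_
    have h1 : 1 - x ≠ 0 := by linarith [hx.2]
    have h2 : 1 + x ≠ 0 := by linarith [hx.1]
    rw [show 1 - x ^ 2 = (1 - x) * (1 + x) by ring, Real.log_mul h1 h2]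
    ring
  have hsub : (∫ x in (0 : ℝ)..1, Real.log (1 - x) * (x / (1 + x ^ 2))) -
      ∫ x in (0 : ℝ)..1, Real.log (1 + x) * (x / (1 + x ^ 2)) =
      -Real.pi ^ 2 / 12 - -Real.pi ^ 2 / 48 := by
    rw [← integral_log_div_one_add, ← integral_log_mul_div_one_add_sq,
      ← intervalIntegral.integral_sub i1 i2, ← intervalIntegral.integral_sub
        (intervalIntegrable_log_mul continuousOn_one_div_one_add)
        (intervalIntegrable_log_mul hc.continuousOn), integral_comp_cayley_unit]
    refine integral_congr_Ioo_of_le zero_le_one fun t ht => ?_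
    simp only [log_one_sub_cayley ht, log_one_add_cayley ht]
    have h0 := ht.1
    have h1 : 1 + t ≠ 0 := by linarith
    rw [show 1 + ((1 - t) / (1 + t)) ^ 2 = 2 * (1 + t ^ 2) / (1 + t) ^ 2 by field_simp; ring]
    field_simp
    ring
  linarith

lemma integral_log_combination :
    ∫ x in (0 : ℝ)..1, (Real.log (1 - x) * (1 - x) ^ 2 - 2 * Real.log x * (x * (1 - x))) /
      ((2 - x) * (1 + x ^ 2)) =
      3 * Real.log 2 ^ 2 / 10 + Real.pi * Real.log 2 / 20 - Real.pi ^ 2 / 60 := by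
  have c1 := continuousOn_one_div_two_sub
  have c2 := continuous_one_div_one_add_sq.continuousOn (s := Icc (0 : ℝ) 1)
  have c3 := continuous_div_one_add_sq.continuousOn (s := Icc (0 : ℝ) 1)
  have i1 := (intervalIntegrable_log_one_sub_mul c1).const_mul (1 / 5)
  have i2 := (intervalIntegrable_log_one_sub_mul c2).const_mul (2 / 5)
  have i3 := (intervalIntegrable_log_one_sub_mul c3).const_mul (4 / 5)
  have i4 := (intervalIntegrable_log_mul c1).const_mul (4 / 5)
  have i5 := (intervalIntegrable_log_mul c2).const_mul (2 / 5)
  have i6 := (intervalIntegrable_log_mul c3).const_mul (6 / 5)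
  have h : ∫ x in (0 : ℝ)..1, (Real.log (1 - x) * (1 - x) ^ 2 - 2 * Real.log x * (x * (1 - x))) /
      ((2 - x) * (1 + x ^ 2)) = ∫ x in (0 : ℝ)..1,
      (1 / 5 * (Real.log (1 - x) * (1 / (2 - x))) + 2 / 5 * (Real.log (1 - x) * (1 / (1 + x ^ 2)))
        - 4 / 5 * (Real.log (1 - x) * (x / (1 + x ^ 2))) + 4 / 5 * (Real.log x * (1 / (2 - x)))
        - 2 / 5 * (Real.log x * (1 / (1 + x ^ 2))) - 6 / 5 * (Real.log x * (x / (1 + x ^ 2)))) := by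
    refine integral_congr_Ioo_of_le zero_le_one fun x hx => ?_
    have h1 : 2 - x ≠ 0 := by linarith [hx.2]
    have h2 : 1 + x ^ 2 ≠ 0 := by positivity
    field_simp
    ring
  rw [h, intervalIntegral.integral_sub ((((i1.add i2).sub i3).add i4).sub i5) i6,
    intervalIntegral.integral_sub (((i1.add i2).sub i3).add i4) i5,
    intervalIntegral.integral_add ((i1.add i2).sub i3) i4,
    intervalIntegral.integral_sub (i1.add i2) i3, intervalIntegral.integral_add i1 i2]
  simp only [intervalIntegral.integral_const_mul]
  rw [integral_log_one_sub_div_two_sub, integral_log_one_sub_mul_div_one_add_sq,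
    integral_log_div_two_sub, integral_log_mul_div_one_add_sq]
  linear_combination 2 / 5 * integral_log_one_sub_sub_log_div_one_add_sq

lemma integral_log_pow_term (k : ℕ) :
    ∫ x in (0 : ℝ)..1, (Real.log (1 - x) * (1 - x) ^ 2 - 2 * Real.log x * (x * (1 - x))) / 2 *
      (x * (1 - x) ^ 2 / 2) ^ k =
      (harmonicNum (2 * (k + 1)) - harmonicNum (k + 1)) /
        ((k + 1 : ℝ) * 2 ^ (k + 1) * (Nat.choose (3 * (k + 1)) (k + 1) : ℝ)) := by
  have h : ∀ x : ℝ, (Real.log (1 - x) * (1 - x) ^ 2 - 2 * Real.log x * (x * (1 - x))) / 2 *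
      (x * (1 - x) ^ 2 / 2) ^ k =
      1 / 2 ^ (k + 1) * (Real.log (1 - x) * (x ^ k * (1 - x) ^ (2 * k + 2))) -
        2 / 2 ^ (k + 1) * (Real.log x * (x ^ (k + 1) * (1 - x) ^ (2 * k + 1))) := by
    intro x
    rw [div_pow, mul_pow, ← pow_mul]
    field_simp
    ring
  simp only [h]
  rw [intervalIntegral.integral_sub
    ((intervalIntegrable_log_one_sub_mul (by fun_prop)).const_mul _)
    ((intervalIntegrable_log_mul (by fun_prop)).const_mul _),
    intervalIntegral.integral_const_mul, intervalIntegral.integral_const_mul,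
    integral_log_one_sub_mul_pow_mul_pow, integral_log_mul_pow_mul_pow,
    Nat.cast_choose ℝ (show k + 1 ≤ 3 * (k + 1) by lia),
    show 3 * (k + 1) - (k + 1) = (2 * k + 1) + 1 by lia,
    show k + (2 * k + 2) + 1 = 3 * (k + 1) by ring,
    show k + 1 + (2 * k + 1) + 1 = 3 * (k + 1) by ring,
    show 2 * (k + 1) = (2 * k + 1) + 1 by ring,
    show 2 * k + 2 = (2 * k + 1) + 1 by ring,
    Nat.factorial_succ (2 * k + 1), Nat.factorial_succ k]
  have : ((3 * (k + 1)).factorial : ℝ) ≠ 0 := by positivity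
  have : ((2 * k + 1).factorial : ℝ) ≠ 0 := by positivity
  have : (k.factorial : ℝ) ≠ 0 := by positivity
  push_cast
  field_simp
  ring

theorem sun_inv3k_H2kHk_one :
    ∑' k : ℕ, (harmonicNum (2 * (k + 1)) - harmonicNum (k + 1)) /
        ((k + 1 : ℝ) * 2 ^ (k + 1) * (Nat.choose (3 * (k + 1)) (k + 1) : ℝ)) =
      3 * Real.log 2 ^ 2 / 10 + Real.pi * Real.log 2 / 20 - Real.pi ^ 2 / 60 := by
  simp only [← integral_log_pow_term]
  rw [← integral_log_combination]
  set g : ℝ → ℝ := fun x =>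
    (Real.log (1 - x) * (1 - x) ^ 2 - 2 * Real.log x * (x * (1 - x))) / 2 with hg
  have hgi : IntervalIntegrable g volume 0 1 := by
    have h := ((intervalIntegrable_log_one_sub_mul (f := fun x => (1 - x) ^ 2 / 2)
      (by fun_prop)).sub (intervalIntegrable_log_mul (f := fun x => x * (1 - x)) (by fun_prop)))
    convert h using 1
    ext x
    simp only [hg]
    ring
  have hw : ∀ x ∈ uIoc (0 : ℝ) 1, |x * (1 - x) ^ 2 / 2| ≤ 1 / 2 := by
    intro x hx
    rw [uIoc_of_le zero_le_one] at hx
    have h0 := hx.1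
    have h1 : (1 - x) ^ 2 ≤ 1 := by nlinarith [hx.2]
    rw [abs_of_nonneg (by positivity)]
    nlinarith [hx.2, sq_nonneg (1 - x)]
  refine (intervalIntegral.hasSum_integral_of_dominated_convergence
    (F := fun k x => g x * (x * (1 - x) ^ 2 / 2) ^ k)
    (fun k x => |g x| * (1 / 2) ^ k) ?_ ?_ ?_ ?_ ?_).tsum_eq
  · intro k
    exact (hgi.mul_continuousOn
      (g := fun x => (x * (1 - x) ^ 2 / 2) ^ k) (by fun_prop)).def'.aestronglyMeasurable
  · intro k
    refine Filter.Eventually.of_forall fun x hx => ?_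
    rw [norm_mul, norm_pow, Real.norm_eq_abs, Real.norm_eq_abs]
    gcongr
    exact hw x hx
  · exact Filter.Eventually.of_forall fun x _ => summable_geometric_two.mul_left _
  · simp only [tsum_mul_left]
    exact hgi.abs.mul_const _
  · refine Filter.Eventually.of_forall fun x hx => ?_
    have hlt : ‖x * (1 - x) ^ 2 / 2‖ < 1 := by
      rw [Real.norm_eq_abs]
      linarith [hw x hx]
    have hsum := (hasSum_geometric_of_norm_lt_one hlt).mul_left (g x)
    rw [uIoc_of_le zero_le_one] at hx
    have h1 : 2 - x ≠ 0 := by linarith [hx.2]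
    have h2 : 1 + x ^ 2 ≠ 0 := by positivity
    have hval : (Real.log (1 - x) * (1 - x) ^ 2 - 2 * Real.log x * (x * (1 - x))) /
        ((2 - x) * (1 + x ^ 2)) = g x * (1 - x * (1 - x) ^ 2 / 2)⁻¹ := by
      rw [show 1 - x * (1 - x) ^ 2 / 2 = (2 - x) * (1 + x ^ 2) / 2 by ring]
      simp only [hg]
      field_simp
    rw [hval]
    exact hsum
end

section
/- The convergent series ∑_{k=0}^∞ (C(2k,k)/8^k)·H_k^{(2)} equals −12√2·Li₂(√2 − 1) − 4√2·(log(1+√2))² + 11π²/(6√2), where Li₂(x) = ∑_{n=1}^∞ xⁿ/n² is the dilogarithm. -/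
open scoped BigOperators

/-- Second-order harmonic number `H_m^{(2)} = ∑_{j=1}^m 1/j²`. -/
noncomputable def harmonic2 (m : ℕ) : ℝ := ∑ j ∈ Finset.range m, 1 / (j + 1 : ℝ) ^ 2

/-- The real dilogarithm `Li₂(x) = ∑_{n=1}^∞ xⁿ/n²` (for `|x| < 1`). -/
noncomputable def dilog (x : ℝ) : ℝ := ∑' n : ℕ, x ^ (n + 1) / (n + 1 : ℝ) ^ 2

section PowerSeries

lemma summable_mul_pow_of_abs_le_sq {c : ℕ → ℝ} (hc : ∀ k, |c k| ≤ ((k : ℝ) + 1) ^ 2) {x : ℝ}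
    (hx : |x| < 1) : Summable fun k => c k * x ^ k := by
  have h (m : ℕ) : Summable fun k : ℕ => (k : ℝ) ^ m * |x| ^ k :=
    summable_pow_mul_geometric_of_norm_lt_one m (by simpa using hx)
  refine Summable.of_norm_bounded (g := fun k : ℕ => ((k : ℝ) + 1) ^ 2 * |x| ^ k) ?_ fun k => ?_
  · refine (((h 2).add ((h 1).mul_left 2)).add (h 0)).congr fun k => ?_
    ring
  · rw [Real.norm_eq_abs, abs_mul, abs_pow]
    gcongr
    exact hc k

lemma exists_hasDerivAt_tsum_mul_pow {c : ℕ → ℝ} (hc : ∀ k, |c k| ≤ (k : ℝ) + 1) {x : ℝ}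
    (hx : |x| < 1) :
    ∃ d, HasDerivAt (fun y => ∑' k, c k * y ^ k) d x ∧
      (1 - x) * d = ∑' k : ℕ, ((k + 1) * c (k + 1) - k * c k) * x ^ k ∧
      x * d = ∑' k : ℕ, k * c k * x ^ k := by
  have hc2 : ∀ k, |c k| ≤ ((k : ℝ) + 1) ^ 2 := fun k =>
    (hc k).trans (by nlinarith [k.cast_nonneg (α := ℝ)])
  have hkc : ∀ k : ℕ, |k * c k| ≤ ((k : ℝ) + 1) ^ 2 := fun k => by
    rw [abs_mul, Nat.abs_cast, sq]
    gcongr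
    · linarith
    · exact hc k
  have hs := summable_mul_pow_of_abs_le_sq hkc hx
  obtain ⟨r, hxr, hr1⟩ := exists_between hx
  have hr0 : 0 < r := (abs_nonneg x).trans_lt hxr
  have hbound : Summable fun n : ℕ => ((n : ℝ) + 1) * (n * r ^ (n - 1)) := by
    rw [← summable_nat_add_iff 1]
    have h (m : ℕ) : Summable fun k : ℕ => (k : ℝ) ^ m * r ^ k :=
      summable_pow_mul_geometric_of_norm_lt_one m (by simpa [abs_of_pos hr0] using hr1)
    refine (((h 2).add ((h 1).mul_left 3)).add ((h 0).mul_left 2)).congr fun k => ?_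
    push_cast
    ring
  have hx_mem : x ∈ Metric.ball (0 : ℝ) r := by simpa using hxr
  have hderiv := hasDerivAt_tsum_of_isPreconnected hbound Metric.isOpen_ball
    (convex_ball (0 : ℝ) r).isPreconnected (g := fun n y => c n * y ^ n)
    (g' := fun n y => c n * (n * y ^ (n - 1)))
    (fun n y _ => (hasDerivAt_pow n y).const_mul (c n))
    (fun n y hy => by
      have hy : |y| < r := by simpa using hy
      rw [Real.norm_eq_abs, abs_mul, abs_mul, abs_pow, Nat.abs_cast]
      gcongr
      exact hc n)
    hx_mem (summable_mul_pow_of_abs_le_sq hc2 hx) hx_mem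
  have hs' : Summable fun n : ℕ => c n * (n * x ^ (n - 1)) := by
    refine Summable.of_norm_bounded hbound fun n => ?_
    rw [Real.norm_eq_abs, abs_mul, abs_mul, abs_pow, Nat.abs_cast]
    gcongr
    exact hc n
  have hmul : x * ∑' n : ℕ, c n * (n * x ^ (n - 1)) = ∑' k : ℕ, k * c k * x ^ k := by
    rw [← tsum_mul_left]
    refine tsum_congr fun k => ?_
    rcases k with _ | k
    · simp
    · simp only [Nat.add_sub_cancel]
      ring
  refine ⟨_, hderiv, ?_, hmul⟩
  have hshift : ∑' n : ℕ, c n * (n * x ^ (n - 1)) = ∑' k : ℕ, (k + 1) * c (k + 1) * x ^ k := by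
    rw [hs'.tsum_eq_zero_add]
    simp only [Nat.cast_zero, zero_mul, mul_zero, zero_add, Nat.add_sub_cancel]
    refine tsum_congr fun k => ?_
    push_cast
    ring
  have hs1 : Summable fun k : ℕ => ((k : ℝ) + 1) * c (k + 1) * x ^ k := by
    refine ((summable_nat_add_iff 1).2 hs').congr fun k => ?_
    push_cast
    ring
  rw [sub_mul, one_mul, hmul, hshift, ← hs1.tsum_sub hs]
  refine tsum_congr fun k => ?_
  ring

lemma eq_of_hasDerivAt_sub_zero {f : ℝ → ℝ} {a b : ℝ} (hab : a < b)
    (hf : ContinuousOn f (Set.Icc a b)) (hf' : ∀ x ∈ Set.Ioo a b, HasDerivAt f 0 x) :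
    f a = f b := by
  obtain ⟨c, -, hc⟩ := exists_hasDerivAt_eq_slope f (fun _ => 0) hab hf hf'
  have : b - a ≠ 0 := by linarith
  field_simp at hc
  linarith

end PowerSeries

section Dilog

lemma hasSum_one_div_succ_sq : HasSum (fun n : ℕ => 1 / (n + 1 : ℝ) ^ 2) (Real.pi ^ 2 / 6) := by
  have h := (hasSum_nat_add_iff' 1).2 hasSum_zeta_two
  simpa using h

lemma norm_dilog_term_le {x : ℝ} (hx : |x| ≤ 1) (n : ℕ) :
    ‖x ^ (n + 1) / (n + 1 : ℝ) ^ 2‖ ≤ 1 / (n + 1 : ℝ) ^ 2 := by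
  rw [norm_div, norm_pow, Real.norm_eq_abs, Real.norm_of_nonneg (by positivity)]
  gcongr
  exact pow_le_one₀ (abs_nonneg x) hx

lemma summable_dilog {x : ℝ} (hx : |x| ≤ 1) :
    Summable fun n : ℕ => x ^ (n + 1) / (n + 1 : ℝ) ^ 2 :=
  Summable.of_norm_bounded hasSum_one_div_succ_sq.summable (norm_dilog_term_le hx)

lemma continuousOn_dilog : ContinuousOn dilog (Set.Icc (-1) 1) := by
  unfold dilog
  exact continuousOn_tsum (fun n => by fun_prop) hasSum_one_div_succ_sq.summable
    fun n x hx => norm_dilog_term_le (abs_le.2 hx) n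

lemma dilog_zero : dilog 0 = 0 := by simp [dilog]

lemma dilog_one : dilog 1 = Real.pi ^ 2 / 6 := by
  simpa [dilog] using hasSum_one_div_succ_sq.tsum_eq

lemma dilog_sq {x : ℝ} (hx : |x| ≤ 1) : dilog (x ^ 2) = 2 * (dilog x + dilog (-x)) := by
  have hs := (summable_dilog hx).add (summable_dilog (x := -x) (by simpa using hx))
  have h0 : ∀ k : ℕ, x ^ (2 * k + 1) / ((2 * k : ℕ) + 1 : ℝ) ^ 2 +
      (-x) ^ (2 * k + 1) / ((2 * k : ℕ) + 1 : ℝ) ^ 2 = 0 := fun k => by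
    rw [Odd.neg_pow ⟨k, rfl⟩]
    ring
  have he : Function.Injective fun k : ℕ => 2 * k := fun a b h => by simpa using h
  have ho : Function.Injective fun k : ℕ => 2 * k + 1 := fun a b h => by simpa using h
  have hsplit := tsum_even_add_odd
    (f := fun n : ℕ => x ^ (n + 1) / (n + 1 : ℝ) ^ 2 + (-x) ^ (n + 1) / (n + 1 : ℝ) ^ 2)
    (hs.comp_injective he) (hs.comp_injective ho)
  simp only [h0, tsum_zero, zero_add] at hsplit
  rw [dilog, dilog, dilog,
    ← (summable_dilog hx).tsum_add (summable_dilog (x := -x) (by simpa using hx)),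
    ← hsplit, ← tsum_mul_left]
  refine tsum_congr fun k => ?_
  rw [Even.neg_pow ⟨k + 1, by ring⟩, ← pow_mul]
  push_cast
  field_simp
  ring

lemma dilog_neg_one : dilog (-1) = -(Real.pi ^ 2 / 12) := by
  have h := dilog_sq (x := 1) (by simp)
  rw [one_pow, dilog_one] at h
  linarith

lemma hasDerivAt_dilog {x : ℝ} (hx : |x| < 1) (hx0 : x ≠ 0) :
    HasDerivAt dilog (-Real.log (1 - x) / x) x := by
  have hc : ∀ k : ℕ, |1 / (k : ℝ) ^ 2| ≤ (k : ℝ) + 1 := fun k => by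
    rcases k with _ | k
    · simp
    · rw [abs_of_nonneg (by positivity), div_le_iff₀ (by positivity)]
      push_cast
      nlinarith [k.cast_nonneg (α := ℝ), pow_nonneg (k.cast_nonneg (α := ℝ)) 3,
        pow_nonneg (k.cast_nonneg (α := ℝ)) 2]
  obtain ⟨d, hd, -, hxd⟩ := exists_hasDerivAt_tsum_mul_pow hc hx
  have hsum : x * d = -Real.log (1 - x) := by
    have hs := Real.hasSum_pow_div_log_of_abs_lt_one hx
    have hs0 : Summable fun k : ℕ => (k : ℝ) * (1 / (k : ℝ) ^ 2) * x ^ k := by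
      rw [← summable_nat_add_iff 1]
      refine hs.summable.congr fun k => ?_
      push_cast
      field_simp
    rw [hxd, hs0.tsum_eq_zero_add, ← hs.tsum_eq]
    simp only [Nat.cast_zero, zero_mul, zero_add]
    refine tsum_congr fun k => ?_
    push_cast
    field_simp
  rw [← hsum, mul_div_cancel_left₀ _ hx0]
  refine hd.congr_of_eventuallyEq ?_
  have hev : ∀ᶠ y : ℝ in nhds x, |y| < 1 :=
    (isOpen_lt continuous_abs continuous_const).mem_nhds hx
  filter_upwards [hev] with y hy
  have hs0 : Summable fun k : ℕ => (1 / (k : ℝ) ^ 2) * y ^ k := by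
    rw [← summable_nat_add_iff 1]
    refine (summable_dilog hy.le).congr fun k => ?_
    push_cast
    field_simp
  rw [dilog, hs0.tsum_eq_zero_add]
  simp only [Nat.cast_zero, ne_eq, OfNat.ofNat_ne_zero, not_false_eq_true, zero_pow, div_zero,
    zero_mul, zero_add]
  refine tsum_congr fun k => ?_
  push_cast
  field_simp

lemma HasDerivAt.dilog {f : ℝ → ℝ} {f' l x : ℝ} (hf : HasDerivAt f f' x) (h : |f x| < 1)
    (h0 : f x ≠ 0) (hl : Real.log (1 - f x) = l) :
    HasDerivAt (fun y => _root_.dilog (f y)) (-l / f x * f') x := by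
  subst hl
  exact (hasDerivAt_dilog h h0).comp x hf

lemma continuousAt_log_mul_log {g : ℝ → ℝ} {g' : ℝ} (hg : HasDerivAt g g' 0) (hg0 : g 0 = 0) :
    ContinuousAt (fun x => Real.log x * g x) 0 := by
  have h : Filter.Tendsto (fun x => dslope g 0 x * (x * Real.log x)) (nhds 0) (nhds 0) := by
    have h1 : ContinuousAt (dslope g 0) 0 := continuousAt_dslope_same.2 hg.differentiableAt
    simpa [ContinuousAt] using h1.fun_mul (Real.continuous_mul_log.continuousAt (x := 0))
  rw [ContinuousAt, hg0, mul_zero]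
  refine h.congr fun x => ?_
  have := sub_smul_dslope g 0 x
  simp only [sub_zero, smul_eq_mul, hg0] at this
  rw [← this]
  ring

lemma dilog_add_dilog_one_sub {x : ℝ} (hx0 : 0 < x) (hx1 : x < 1) :
    dilog x + dilog (1 - x) = Real.pi ^ 2 / 6 - Real.log x * Real.log (1 - x) := by
  have hg : HasDerivAt (fun y : ℝ => Real.log (1 - y)) (-1) 0 := by
    simpa using ((hasDerivAt_id' (0 : ℝ)).const_sub 1).log (by simp)
  have key := eq_of_hasDerivAt_sub_zero
    (f := fun y => dilog y + dilog (1 - y) + Real.log y * Real.log (1 - y)) hx0 ?_ ?_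
  · simp only [dilog_zero, sub_zero, dilog_one, Real.log_zero, zero_mul] at key
    linarith
  · refine ContinuousOn.add (ContinuousOn.add ?_ ?_) fun y hy => ContinuousAt.continuousWithinAt ?_
    · exact continuousOn_dilog.mono fun y hy => ⟨by linarith [hy.1], by linarith [hy.2]⟩
    · exact continuousOn_dilog.comp (by fun_prop) fun y hy =>
        ⟨by linarith [hy.2], by linarith [hy.1]⟩
    · rcases hy.1.eq_or_lt with rfl | h
      · exact continuousAt_log_mul_log hg (by simp)
      · have : 1 - y ≠ 0 := by linarith [hy.2]
        fun_prop (disch := first | assumption | exact h.ne')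
  · intro y ⟨hy0, hyx⟩
    have h1 : 1 - y ≠ 0 := by linarith
    have hd := (((hasDerivAt_id' y).dilog (by simpa [abs_of_pos hy0] using hyx.trans hx1) hy0.ne'
      rfl).fun_add (((hasDerivAt_id' y).const_sub 1).dilog (l := Real.log y)
        (by rw [abs_lt]; constructor <;> linarith) h1 (by simp))).fun_add
      ((Real.hasDerivAt_log hy0.ne').fun_mul (((hasDerivAt_id' y).const_sub 1).log h1))
    refine hd.congr_deriv ?_
    field_simp
    ring

lemma dilog_sub_dilog_neg {x : ℝ} (hx0 : 0 < x) (hx1 : x < 1) :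
    dilog x - dilog (-x) + (dilog ((1 - x) / (1 + x)) - dilog (-((1 - x) / (1 + x)))) =
      Real.pi ^ 2 / 4 + Real.log x * (Real.log (1 + x) - Real.log (1 - x)) := by
  have hg : HasDerivAt (fun y : ℝ => Real.log (1 + y) - Real.log (1 - y)) (1 - -1) 0 := by
    simpa using (((hasDerivAt_id' (0 : ℝ)).const_add 1).log (by simp)).fun_sub
      (((hasDerivAt_id' (0 : ℝ)).const_sub 1).log (by simp))
  have key := eq_of_hasDerivAt_sub_zero
    (f := fun y => dilog y - dilog (-y) + (dilog ((1 - y) / (1 + y)) -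
      dilog (-((1 - y) / (1 + y)))) - Real.log y * (Real.log (1 + y) - Real.log (1 - y))) hx0 ?_ ?_
  · simp only [dilog_zero, neg_zero, add_zero, div_one, sub_zero, dilog_one, Real.log_zero, zero_mul,
      dilog_neg_one] at key
    linarith
  · have hq : ContinuousOn (fun y : ℝ => (1 - y) / (1 + y)) (Set.Icc 0 x) :=
      ContinuousOn.div (by fun_prop) (by fun_prop) fun y hy => by linarith [hy.1]
    have hq' : ∀ y ∈ Set.Icc 0 x, 0 ≤ (1 - y) / (1 + y) ∧ (1 - y) / (1 + y) ≤ 1 := fun y hy =>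
      ⟨div_nonneg (by linarith [hy.2]) (by linarith [hy.1]),
        (div_le_one (by linarith [hy.1])).2 (by linarith [hy.1])⟩
    refine ContinuousOn.sub (ContinuousOn.add (ContinuousOn.sub ?_ ?_) (ContinuousOn.sub ?_ ?_))
      fun y hy => ContinuousAt.continuousWithinAt ?_
    · exact continuousOn_dilog.mono fun y hy => ⟨by linarith [hy.1], by linarith [hy.2]⟩
    · exact continuousOn_dilog.comp (by fun_prop) fun y hy =>
        ⟨by linarith [hy.2], by linarith [hy.1]⟩
    · exact continuousOn_dilog.comp hq fun y hy =>
        ⟨by linarith [(hq' y hy).1], (hq' y hy).2⟩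
    · exact continuousOn_dilog.comp hq.fun_neg fun y hy =>
        ⟨by linarith [(hq' y hy).2], by linarith [(hq' y hy).1]⟩
    · rcases hy.1.eq_or_lt with rfl | h
      · exact continuousAt_log_mul_log hg (by simp)
      · have h1 : 1 - y ≠ 0 := by linarith [hy.2]
        have h2 : 1 + y ≠ 0 := by linarith
        fun_prop (disch := first | assumption | exact h.ne')
  · intro y ⟨hy0, hyx⟩
    have h1 : 0 < 1 - y := by linarith
    have h2 : 0 < 1 + y := by linarith
    have hq : HasDerivAt (fun y : ℝ => (1 - y) / (1 + y)) (-2 / (1 + y) ^ 2) y := by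
      refine HasDerivAt.congr_deriv (((hasDerivAt_id' y).const_sub 1).fun_div
        ((hasDerivAt_id' y).const_add 1) h2.ne') ?_
      ring
    have hqp : 0 < (1 - y) / (1 + y) := by positivity
    have hq1 : |(1 - y) / (1 + y)| < 1 := by
      rw [abs_of_pos hqp, div_lt_one h2]
      linarith
    have hy1 : |y| < 1 := by
      rw [abs_of_pos hy0]
      linarith
    have hl1 : Real.log (1 - (1 - y) / (1 + y)) = Real.log 2 + Real.log y - Real.log (1 + y) := by
      rw [← Real.log_mul (by simp) hy0.ne', ← Real.log_div (by positivity) h2.ne']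
      congr 1
      field_simp
      ring
    have hl2 : Real.log (1 - -((1 - y) / (1 + y))) = Real.log 2 - Real.log (1 + y) := by
      rw [← Real.log_div (by positivity) h2.ne']
      congr 1
      field_simp
      ring
    have hd := ((((hasDerivAt_id' y).dilog hy1 hy0.ne' rfl).fun_sub
      ((hasDerivAt_id' y).fun_neg.dilog (l := Real.log (1 + y)) (by simpa using hy1)
        (by simpa using hy0.ne') (by simp))).fun_add ((hq.dilog hq1 hqp.ne' hl1).fun_sub (hq.fun_neg.dilog (by simpa using hq1)
          (by simpa using ⟨h1.ne', h2.ne'⟩) hl2))).fun_sub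
      ((Real.hasDerivAt_log hy0.ne').fun_mul ((((hasDerivAt_id' y).const_add 1).log h2.ne').fun_sub
        (((hasDerivAt_id' y).const_sub 1).log h1.ne')))
    refine hd.congr_deriv ?_
    field_simp
    ring

lemma dilog_neg_sq {x : ℝ} (hx0 : 0 < x) (hx1 : x < 1) :
    dilog x + dilog (-x) - dilog (-x ^ 2) =
      dilog ((x + x ^ 2) / (1 + x ^ 2)) - dilog ((x - x ^ 2) / (1 + x)) -
        (Real.log (1 + x) - Real.log (1 + x ^ 2)) ^ 2 / 2 +
        (Real.log (1 - x) - Real.log (1 + x ^ 2)) * (Real.log (1 + x) - Real.log (1 + x ^ 2)) := by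
  have key := eq_of_hasDerivAt_sub_zero
    (f := fun x => dilog x + dilog (-x) - dilog (-x ^ 2) -
      (dilog ((x + x ^ 2) / (1 + x ^ 2)) - dilog ((x - x ^ 2) / (1 + x)) -
        (Real.log (1 + x) - Real.log (1 + x ^ 2)) ^ 2 / 2 +
        (Real.log (1 - x) - Real.log (1 + x ^ 2)) * (Real.log (1 + x) - Real.log (1 + x ^ 2))))
    hx0 ?_ ?_
  · simp [dilog_zero] at key
    linarith
  · have hI : ∀ y ∈ Set.Icc 0 x, 0 < 1 - y ∧ 0 < 1 + y ∧ 0 < 1 + y ^ 2 := fun y hy =>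
      ⟨by linarith [hy.2], by linarith [hy.1], by positivity⟩
    have hp : ContinuousOn (fun y : ℝ => (y + y ^ 2) / (1 + y ^ 2)) (Set.Icc 0 x) :=
      ContinuousOn.div (by fun_prop) (by fun_prop) fun y hy => (hI y hy).2.2.ne'
    have hr : ContinuousOn (fun y : ℝ => (y - y ^ 2) / (1 + y)) (Set.Icc 0 x) :=
      ContinuousOn.div (by fun_prop) (by fun_prop) fun y hy => (hI y hy).2.1.ne'
    have hl1 : ContinuousOn (fun y : ℝ => Real.log (1 + y)) (Set.Icc 0 x) :=
      ContinuousOn.log (by fun_prop) fun y hy => (hI y hy).2.1.ne'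
    have hl2 : ContinuousOn (fun y : ℝ => Real.log (1 + y ^ 2)) (Set.Icc 0 x) :=
      ContinuousOn.log (by fun_prop) fun y hy => (hI y hy).2.2.ne'
    have hl3 : ContinuousOn (fun y : ℝ => Real.log (1 - y)) (Set.Icc 0 x) :=
      ContinuousOn.log (by fun_prop) fun y hy => (hI y hy).1.ne'
    have hc1 : ContinuousOn (fun y : ℝ => dilog y) (Set.Icc 0 x) :=
      continuousOn_dilog.mono fun y hy => ⟨by linarith [hy.1], by linarith [hy.2]⟩
    have hc2 : ContinuousOn (fun y : ℝ => dilog (-y)) (Set.Icc 0 x) :=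
      continuousOn_dilog.comp (by fun_prop) fun y hy => ⟨by linarith [hy.2], by linarith [hy.1]⟩
    have hc3 : ContinuousOn (fun y : ℝ => dilog (-y ^ 2)) (Set.Icc 0 x) :=
      continuousOn_dilog.comp (by fun_prop) fun y hy =>
        ⟨by nlinarith [hy.1, hy.2], by nlinarith [hy.1, hy.2]⟩
    have hc4 : ContinuousOn (fun y : ℝ => dilog ((y + y ^ 2) / (1 + y ^ 2))) (Set.Icc 0 x) :=
      continuousOn_dilog.comp hp fun y hy => by
        obtain ⟨h1, h2, h3⟩ := hI y hy
        exact ⟨(le_div_iff₀ h3).2 (by nlinarith [hy.1]), (div_le_iff₀ h3).2 (by nlinarith [hy.1])⟩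
    have hc5 : ContinuousOn (fun y : ℝ => dilog ((y - y ^ 2) / (1 + y))) (Set.Icc 0 x) :=
      continuousOn_dilog.comp hr fun y hy => by
        obtain ⟨h1, h2, h3⟩ := hI y hy
        exact ⟨(le_div_iff₀ h2).2 (by nlinarith [hy.1]), (div_le_iff₀ h2).2 (by nlinarith [hy.1])⟩
    fun_prop
  · intro y ⟨hy0, hyx⟩
    have h1 : 0 < 1 - y := by linarith
    have h2 : 0 < 1 + y := by linarith
    have h3 : 0 < 1 + y ^ 2 := by positivity
    have hy1 : |y| < 1 := by
      rw [abs_of_pos hy0]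
      linarith
    have hsq : HasDerivAt (fun y : ℝ => y ^ 2) (2 * y) y := by simpa using hasDerivAt_pow 2 y
    have hp : HasDerivAt (fun y : ℝ => (y + y ^ 2) / (1 + y ^ 2))
        ((1 + 2 * y - y ^ 2) / (1 + y ^ 2) ^ 2) y := by
      refine HasDerivAt.congr_deriv (((hasDerivAt_id' y).fun_add hsq).fun_div
        (hsq.const_add 1) h3.ne') ?_
      ring
    have hr : HasDerivAt (fun y : ℝ => (y - y ^ 2) / (1 + y))
        ((1 - 2 * y - y ^ 2) / (1 + y) ^ 2) y := by
      refine HasDerivAt.congr_deriv (((hasDerivAt_id' y).fun_sub hsq).fun_div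
        ((hasDerivAt_id' y).const_add 1) h2.ne') ?_
      ring
    have hpp : 0 < (y + y ^ 2) / (1 + y ^ 2) := by positivity
    have hrp : 0 < (y - y ^ 2) / (1 + y) := div_pos (by nlinarith) h2
    have hp1 : |(y + y ^ 2) / (1 + y ^ 2)| < 1 := by
      rw [abs_of_pos hpp, div_lt_one h3]
      linarith
    have hr1 : |(y - y ^ 2) / (1 + y)| < 1 := by
      rw [abs_of_pos hrp, div_lt_one h2]
      nlinarith
    have hpl : Real.log (1 - (y + y ^ 2) / (1 + y ^ 2)) =
        Real.log (1 - y) - Real.log (1 + y ^ 2) := by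
      rw [← Real.log_div h1.ne' h3.ne']
      congr 1
      field_simp
      ring
    have hrl : Real.log (1 - (y - y ^ 2) / (1 + y)) =
        Real.log (1 + y ^ 2) - Real.log (1 + y) := by
      rw [← Real.log_div h3.ne' h2.ne']
      congr 1
      field_simp
      ring
    have hl1 : HasDerivAt (fun y : ℝ => Real.log (1 + y)) (1 / (1 + y)) y :=
      ((hasDerivAt_id' y).const_add 1).log h2.ne'
    have hl2 : HasDerivAt (fun y : ℝ => Real.log (1 + y ^ 2)) (2 * y / (1 + y ^ 2)) y :=
      (hsq.const_add 1).log h3.ne'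
    have hl3 : HasDerivAt (fun y : ℝ => Real.log (1 - y)) (-1 / (1 - y)) y :=
      ((hasDerivAt_id' y).const_sub 1).log h1.ne'
    have hd := ((((hasDerivAt_id' y).dilog hy1 hy0.ne' rfl).fun_add
      ((hasDerivAt_id' y).fun_neg.dilog (l := Real.log (1 + y)) (by simpa using hy1)
        (by simpa using hy0.ne') (by simp))).fun_sub
      (hsq.fun_neg.dilog (l := Real.log (1 + y ^ 2)) (by
        simpa [abs_of_pos hy0] using hyx.trans hx1) (by simpa using hy0.ne')
        (by simp))).fun_sub
      ((((hp.dilog hp1 hpp.ne' hpl).fun_sub (hr.dilog hr1 hrp.ne' hrl)).fun_sub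
        (((hl1.fun_sub hl2).fun_pow 2).div_const 2)).fun_add
          ((hl3.fun_sub hl2).fun_mul (hl1.fun_sub hl2)))
    refine hd.congr_deriv ?_
    have h5 : y + y ^ 2 = y * (1 + y) := by ring
    have h6 : y - y ^ 2 = y * (1 - y) := by ring
    field_simp
    ring

end Dilog

section SilverRatio

lemma dilog_neg_sq_sqrt_two_sub_one :
    dilog (-(Real.sqrt 2 - 1) ^ 2) =
      6 * dilog (Real.sqrt 2 - 1) + 2 * Real.log (1 + Real.sqrt 2) ^ 2 - 11 * Real.pi ^ 2 / 24 := by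
  have hq : Real.sqrt 2 ^ 2 = 2 := Real.sq_sqrt (by norm_num)
  have hq0 : 0 < Real.sqrt 2 := by positivity
  have hs0 : 0 < Real.sqrt 2 - 1 := by nlinarith
  have hs1 : Real.sqrt 2 - 1 < 1 := by nlinarith
  have hinv : Real.sqrt 2 - 1 = (1 + Real.sqrt 2)⁻¹ := by
    refine eq_inv_of_mul_eq_one_left ?_
    linear_combination hq
  have hls : Real.log (Real.sqrt 2 - 1) = -Real.log (1 + Real.sqrt 2) := by
    rw [hinv, Real.log_inv]
  have hl2 : Real.log 2 = 2 * Real.log (Real.sqrt 2) := by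
    rw [Real.log_sqrt (by norm_num)]
    ring
  have h1 := dilog_sub_dilog_neg hs0 hs1
  have h2 := dilog_neg_sq hs0 hs1
  have h3 := dilog_add_dilog_one_sub (x := 1 / 2) (by norm_num) (by norm_num)
  have h4 := dilog_sq (x := Real.sqrt 2 - 1) (by rw [abs_of_pos hs0]; exact hs1.le)
  have e1 : 1 + (Real.sqrt 2 - 1) = Real.sqrt 2 := by ring
  have e2 : 1 - (Real.sqrt 2 - 1) = Real.sqrt 2 * (Real.sqrt 2 - 1) := by linear_combination -hq
  have e3 : 1 + (Real.sqrt 2 - 1) ^ 2 = 2 * Real.sqrt 2 * (Real.sqrt 2 - 1) := by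
    linear_combination -hq
  have e4 : (Real.sqrt 2 - 1 + (Real.sqrt 2 - 1) ^ 2) / (2 * Real.sqrt 2 * (Real.sqrt 2 - 1)) =
      1 / 2 := by
    rw [div_eq_div_iff (by positivity) (by norm_num)]
    ring
  have e5 : (Real.sqrt 2 - 1 - (Real.sqrt 2 - 1) ^ 2) / Real.sqrt 2 = (Real.sqrt 2 - 1) ^ 2 := by
    rw [div_eq_iff hq0.ne']
    linear_combination (1 - Real.sqrt 2) * hq
  have l2 : Real.log (Real.sqrt 2 * (Real.sqrt 2 - 1)) =
      Real.log (Real.sqrt 2) - Real.log (1 + Real.sqrt 2) := by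
    rw [Real.log_mul hq0.ne' hs0.ne', hls]
    ring
  have l3 : Real.log (2 * Real.sqrt 2 * (Real.sqrt 2 - 1)) =
      3 * Real.log (Real.sqrt 2) - Real.log (1 + Real.sqrt 2) := by
    rw [Real.log_mul (by positivity) hs0.ne', Real.log_mul (by norm_num) hq0.ne', hls, hl2]
    ring
  rw [e1, e2, mul_div_cancel_left₀ _ hq0.ne', l2, hls] at h1
  rw [e1, e3, e2, e4, e5, h4, l2, l3] at h2
  have e6 : Real.log (1 / 2) = -(2 * Real.log (Real.sqrt 2)) := by
    rw [one_div, Real.log_inv, hl2]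
  have e7 : (1 : ℝ) - 1 / 2 = 1 / 2 := by norm_num
  rw [e7, e6] at h3
  linear_combination -h2 + (-3 / 2) * h1 - h3 / 2

end SilverRatio

section CentralBinom

/-- The coefficients of the power series of `1 / √(1 - x)`. -/
noncomputable def scaledCentralBinom (k : ℕ) : ℝ := Nat.centralBinom k / 4 ^ k

lemma scaledCentralBinom_succ (k : ℕ) :
    (k + 1) * scaledCentralBinom (k + 1) = (k + 1 / 2) * scaledCentralBinom k := by
  have h : ((k : ℝ) + 1) * Nat.centralBinom (k + 1) = 2 * (2 * k + 1) * Nat.centralBinom k := by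
    exact_mod_cast Nat.succ_mul_centralBinom_succ k
  rw [scaledCentralBinom, scaledCentralBinom, pow_succ]
  field_simp
  linear_combination 2 * h

lemma scaledCentralBinom_nonneg (k : ℕ) : 0 ≤ scaledCentralBinom k := by
  unfold scaledCentralBinom
  positivity

lemma scaledCentralBinom_zero : scaledCentralBinom 0 = 1 := by simp [scaledCentralBinom]

lemma scaledCentralBinom_le_one (k : ℕ) : scaledCentralBinom k ≤ 1 := by
  induction k with
  | zero => exact scaledCentralBinom_zero.le
  | succ k ih =>
    have h := scaledCentralBinom_succ k
    have hk : (0 : ℝ) < k + 1 := by positivity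
    have := scaledCentralBinom_nonneg k
    refine le_of_mul_le_mul_left ?_ hk
    nlinarith

lemma harmonic2_nonneg (k : ℕ) : 0 ≤ harmonic2 k := by
  unfold harmonic2
  positivity

lemma harmonic2_succ (k : ℕ) : harmonic2 (k + 1) = harmonic2 k + 1 / (k + 1 : ℝ) ^ 2 :=
  Finset.sum_range_succ _ _

lemma harmonic2_le (k : ℕ) : harmonic2 k ≤ k := by
  unfold harmonic2
  refine (Finset.sum_le_card_nsmul _ _ 1 fun j _ => ?_).trans (by simp)
  rw [div_le_one (by positivity)]
  nlinarith [j.cast_nonneg (α := ℝ)]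

lemma tsum_eq_of_coeff_zero (c : ℕ → ℝ) : ∑' k, c k * (0 : ℝ) ^ k = c 0 := by
  rw [tsum_eq_single 0 fun k hk => by simp [hk]]
  simp

lemma abs_scaledCentralBinom_le (k : ℕ) : |scaledCentralBinom k| ≤ (k : ℝ) + 1 := by
  rw [abs_of_nonneg (scaledCentralBinom_nonneg k)]
  linarith [scaledCentralBinom_le_one k, k.cast_nonneg (α := ℝ)]

lemma abs_scaledCentralBinom_div_le (k : ℕ) : |scaledCentralBinom k / k| ≤ (k : ℝ) + 1 := by
  rw [abs_div, Nat.abs_cast]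
  rcases k with _ | k
  · simp
  · refine (div_le_self (abs_nonneg _) ?_).trans (abs_scaledCentralBinom_le _)
    push_cast
    linarith [k.cast_nonneg (α := ℝ)]

lemma abs_scaledCentralBinom_mul_harmonic2_le (k : ℕ) :
    |scaledCentralBinom k * harmonic2 k| ≤ (k : ℝ) + 1 := by
  rw [abs_of_nonneg (mul_nonneg (scaledCentralBinom_nonneg k) (harmonic2_nonneg k))]
  nlinarith [scaledCentralBinom_le_one k, scaledCentralBinom_nonneg k, harmonic2_le k,
    harmonic2_nonneg k]

lemma hasDerivAt_comp_one_sub_sq {f : ℝ → ℝ} {d w : ℝ} (hf : HasDerivAt f d (1 - w ^ 2)) :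
    HasDerivAt (fun y => f (1 - y ^ 2)) (d * -(2 * w)) w :=
  HasDerivAt.comp w hf (by simpa using (hasDerivAt_pow 2 w).const_sub 1)

lemma abs_one_sub_sq_lt {w : ℝ} (hw0 : 0 < w) (hw1 : w ≤ 1) : |1 - w ^ 2| < 1 := by
  rw [abs_lt]
  constructor <;> nlinarith

lemma continuousOn_tsum_one_sub_sq {c : ℕ → ℝ} (hc : ∀ k, |c k| ≤ (k : ℝ) + 1) {w : ℝ}
    (hw0 : 0 < w) : ContinuousOn (fun y : ℝ => ∑' k, c k * (1 - y ^ 2) ^ k) (Set.Icc w 1) :=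
  fun y hy => by
    obtain ⟨d, hd, -⟩ := exists_hasDerivAt_tsum_mul_pow hc
      (abs_one_sub_sq_lt (hw0.trans_le hy.1) hy.2)
    exact (hasDerivAt_comp_one_sub_sq hd).continuousAt.continuousWithinAt

lemma tsum_scaledCentralBinom {w : ℝ} (hw0 : 0 < w) (hw1 : w < 1) :
    w * ∑' k, scaledCentralBinom k * (1 - w ^ 2) ^ k = 1 := by
  have key := eq_of_hasDerivAt_sub_zero
    (f := fun y => y * ∑' k, scaledCentralBinom k * (1 - y ^ 2) ^ k) hw1
    (continuousOn_id.mul (continuousOn_tsum_one_sub_sq abs_scaledCentralBinom_le hw0)) ?_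
  · simpa [tsum_eq_of_coeff_zero, scaledCentralBinom_zero] using key
  · intro y ⟨hwy, hy1⟩
    obtain ⟨d, hd, hd', -⟩ := exists_hasDerivAt_tsum_mul_pow abs_scaledCentralBinom_le
      (abs_one_sub_sq_lt (hw0.trans hwy) hy1.le)
    have hsum : ∑' k : ℕ, ((k + 1) * scaledCentralBinom (k + 1) - k * scaledCentralBinom k) *
        (1 - y ^ 2) ^ k = 1 / 2 * ∑' k, scaledCentralBinom k * (1 - y ^ 2) ^ k := by
      rw [← tsum_mul_left]
      refine tsum_congr fun k => ?_
      rw [scaledCentralBinom_succ]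
      ring
    rw [hsum] at hd'
    refine HasDerivAt.congr_deriv ((hasDerivAt_id' y).fun_mul (hasDerivAt_comp_one_sub_sq hd)) ?_
    linear_combination (-2) * hd'

lemma tsum_scaledCentralBinom_div {w : ℝ} (hw0 : 0 < w) (hw1 : w < 1) :
    ∑' k : ℕ, scaledCentralBinom k / k * (1 - w ^ 2) ^ k =
      2 * (Real.log 2 - Real.log (1 + w)) := by
  have key := eq_of_hasDerivAt_sub_zero
    (f := fun y => ∑' k : ℕ, scaledCentralBinom k / k * (1 - y ^ 2) ^ k -
      2 * (Real.log 2 - Real.log (1 + y))) hw1 ?_ ?_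
  · norm_num [tsum_eq_of_coeff_zero] at key
    linarith
  · have hl : ContinuousOn (fun y : ℝ => Real.log (1 + y)) (Set.Icc w 1) :=
      ContinuousOn.log (by fun_prop) fun y hy => by linarith [hy.1]
    exact (continuousOn_tsum_one_sub_sq abs_scaledCentralBinom_div_le hw0).fun_sub (by fun_prop)
  · intro y ⟨hwy, hy1⟩
    have hy0 := hw0.trans hwy
    have hx := abs_one_sub_sq_lt hy0 hy1.le
    obtain ⟨d, hd, -, hd'⟩ := exists_hasDerivAt_tsum_mul_pow abs_scaledCentralBinom_div_le hx
    have hA := tsum_scaledCentralBinom hy0 hy1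
    have hs : Summable fun k => scaledCentralBinom k * (1 - y ^ 2) ^ k :=
      summable_mul_pow_of_abs_le_sq (fun k => (abs_scaledCentralBinom_le k).trans
        (by nlinarith [k.cast_nonneg (α := ℝ)])) hx
    have hs' : Summable fun k : ℕ => k * (scaledCentralBinom k / k) * (1 - y ^ 2) ^ k := by
      rw [← summable_nat_add_iff 1] at hs ⊢
      refine hs.congr fun k => ?_
      rw [mul_div_cancel₀ _ (by positivity)]
    have hsum : ∑' k : ℕ, k * (scaledCentralBinom k / k) * (1 - y ^ 2) ^ k =
        ∑' k, scaledCentralBinom k * (1 - y ^ 2) ^ k - 1 := by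
      rw [hs.tsum_eq_zero_add, hs'.tsum_eq_zero_add, scaledCentralBinom_zero]
      simp only [Nat.cast_zero, zero_mul, zero_add, pow_zero, mul_one, add_sub_cancel_left]
      refine tsum_congr fun k => ?_
      rw [mul_div_cancel₀ _ (by positivity)]
    rw [hsum] at hd'
    have h1 : 1 - y ≠ 0 := by linarith
    have h2 : 1 + y ≠ 0 := by linarith
    have hyd : y * (1 + y) * d = 1 := by
      refine mul_left_cancel₀ h1 ?_
      linear_combination y * hd' + hA
    refine HasDerivAt.congr_deriv ((hasDerivAt_comp_one_sub_sq hd).fun_sub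
      (((((hasDerivAt_id' y).const_add 1).log h2).const_sub (Real.log 2)).const_mul 2)) ?_
    field_simp
    linear_combination (-2) * hyd

lemma tsum_scaledCentralBinom_mul_harmonic2 {w : ℝ} (hw0 : 0 < w) (hw1 : w < 1) :
    w * ∑' k, scaledCentralBinom k * harmonic2 k * (1 - w ^ 2) ^ k =
      -2 * dilog ((w - 1) / (w + 1)) := by
  have key := eq_of_hasDerivAt_sub_zero
    (f := fun y => y * ∑' k, scaledCentralBinom k * harmonic2 k * (1 - y ^ 2) ^ k -
      -2 * dilog ((y - 1) / (y + 1))) hw1 ?_ ?_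
  · have h0 : harmonic2 0 = 0 := by simp [harmonic2]
    norm_num [tsum_eq_of_coeff_zero, dilog_zero, h0] at key
    linarith
  · have hq : ContinuousOn (fun y : ℝ => (y - 1) / (y + 1)) (Set.Icc w 1) :=
      ContinuousOn.div (by fun_prop) (by fun_prop) fun y hy => by linarith [hy.1]
    refine (continuousOn_id.mul
      (continuousOn_tsum_one_sub_sq abs_scaledCentralBinom_mul_harmonic2_le hw0)).fun_sub
      (continuousOn_const.mul (continuousOn_dilog.comp hq fun y hy => ?_))
    have h2 : 0 < y + 1 := by linarith [hy.1]
    exact ⟨(le_div_iff₀ h2).2 (by linarith [hy.1]), (div_le_iff₀ h2).2 (by linarith [hy.1])⟩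
  · intro y ⟨hwy, hy1⟩
    have hy0 := hw0.trans hwy
    have hx := abs_one_sub_sq_lt hy0 hy1.le
    obtain ⟨d, hd, hd', -⟩ :=
      exists_hasDerivAt_tsum_mul_pow abs_scaledCentralBinom_mul_harmonic2_le hx
    have hh := tsum_scaledCentralBinom_div hy0 hy1
    have hsG : Summable fun k => scaledCentralBinom k * harmonic2 k * (1 - y ^ 2) ^ k :=
      summable_mul_pow_of_abs_le_sq (fun k => (abs_scaledCentralBinom_mul_harmonic2_le k).trans
        (by nlinarith [k.cast_nonneg (α := ℝ)])) hx
    have hsh : Summable fun k : ℕ => scaledCentralBinom k / k * (1 - y ^ 2) ^ k :=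
      summable_mul_pow_of_abs_le_sq (fun k => (abs_scaledCentralBinom_div_le k).trans
        (by nlinarith [k.cast_nonneg (α := ℝ)])) hx
    have hsum : (1 - y ^ 2) * ∑' k : ℕ, ((k + 1) * (scaledCentralBinom (k + 1) * harmonic2 (k + 1)) -
          k * (scaledCentralBinom k * harmonic2 k)) * (1 - y ^ 2) ^ k =
        (1 - y ^ 2) / 2 * ∑' k, scaledCentralBinom k * harmonic2 k * (1 - y ^ 2) ^ k +
          ∑' k : ℕ, scaledCentralBinom k / k * (1 - y ^ 2) ^ k := by
      rw [hsh.tsum_eq_zero_add, Nat.cast_zero, div_zero, zero_mul, zero_add, ← tsum_mul_left,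
        ← tsum_mul_left, ← (hsG.mul_left _).tsum_add ((summable_nat_add_iff 1).2 hsh)]
      refine tsum_congr fun k => ?_
      have h := scaledCentralBinom_succ k
      have hk : (k : ℝ) + 1 ≠ 0 := by positivity
      rw [harmonic2_succ]
      push_cast
      field_simp
      linear_combination (1 - y ^ 2) ^ k * (1 - y ^ 2) * 2 * (k + 1) * harmonic2 k * h
    rw [← hd', hh] at hsum
    have h1 : 1 - y ≠ 0 := by linarith
    have h1' : y - 1 ≠ 0 := by linarith
    have h2 : 0 < y + 1 := by linarith
    have hq : HasDerivAt (fun y : ℝ => (y - 1) / (y + 1)) (2 / (y + 1) ^ 2) y := by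
      refine HasDerivAt.congr_deriv (((hasDerivAt_id' y).sub_const 1).fun_div
        ((hasDerivAt_id' y).add_const 1) h2.ne') ?_
      ring
    have hq1 : |(y - 1) / (y + 1)| < 1 := by
      rw [abs_lt, lt_div_iff₀ h2, div_lt_iff₀ h2]
      constructor <;> linarith
    have hl : Real.log (1 - (y - 1) / (y + 1)) = Real.log 2 - Real.log (1 + y) := by
      rw [← Real.log_div (by norm_num) (by linarith)]
      congr 1
      field_simp
      ring
    refine HasDerivAt.congr_deriv (((hasDerivAt_id' y).fun_mul (hasDerivAt_comp_one_sub_sq hd)).fun_sub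
      ((hq.dilog hq1 (div_ne_zero h1' h2.ne') hl).const_mul (-2))) ?_
    field_simp
    linear_combination 2 * hsum

end CentralBinom

theorem sun_2k_8_Hk2 :
    ∑' k : ℕ, ((Nat.choose (2 * k) k : ℝ) / 8 ^ k) * harmonic2 k =
      -(12 * Real.sqrt 2) * dilog (Real.sqrt 2 - 1) -
        4 * Real.sqrt 2 * Real.log (1 + Real.sqrt 2) ^ 2 +
        11 * Real.pi ^ 2 / (6 * Real.sqrt 2) := by
  have hq : Real.sqrt 2 ^ 2 = 2 := Real.sq_sqrt (by norm_num)
  have hq0 : 0 < Real.sqrt 2 := by positivity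
  have h := tsum_scaledCentralBinom_mul_harmonic2 (w := Real.sqrt 2 / 2) (by positivity)
    (by nlinarith)
  have e1 : (Real.sqrt 2 / 2 - 1) / (Real.sqrt 2 / 2 + 1) = -(Real.sqrt 2 - 1) ^ 2 := by
    rw [div_eq_iff (by positivity)]
    linear_combination (Real.sqrt 2 / 2) * hq
  have e2 : 1 - (Real.sqrt 2 / 2) ^ 2 = 1 / 2 := by linear_combination -hq / 4
  have e3 : ∑' k, scaledCentralBinom k * harmonic2 k * (1 / 2 : ℝ) ^ k =
      ∑' k : ℕ, ((Nat.choose (2 * k) k : ℝ) / 8 ^ k) * harmonic2 k := by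
    refine tsum_congr fun k => ?_
    rw [scaledCentralBinom, Nat.centralBinom, show (8 : ℝ) = 4 * 2 by norm_num, mul_pow, div_pow,
      one_pow]
    field_simp
  rw [e1, e2, e3, dilog_neg_sq_sqrt_two_sub_one] at h
  have e4 : 11 * Real.pi ^ 2 / (6 * Real.sqrt 2) = 11 * Real.pi ^ 2 * Real.sqrt 2 / 12 := by
    rw [div_eq_div_iff (by positivity) (by norm_num)]
    linear_combination (-66) * Real.pi ^ 2 * hq
  rw [e4]
  refine mul_left_cancel₀ (div_pos hq0 two_pos).ne' (h.trans ?_)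
  linear_combination (6 * dilog (Real.sqrt 2 - 1) + 2 * Real.log (1 + Real.sqrt 2) ^ 2 -
    11 * Real.pi ^ 2 / 24) * hq
end
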